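/- Assume 0 ≤ aᵢ < bᵢ for i = 1,2,3, and that a₁b₂ ≤ b₁a₂, a₁b₃ ≤ b₁a₃, and a₂b₃ ≤ b₂a₃. Then the 4-dimensional Lebesgue volume of the convex hull of the set {(x₁x₂x₃, x₁, x₂, x₃) ∈ ℝ⁴ : xᵢ ∈ [aᵢ, bᵢ] for i = 1,2,3} equals (b₁−a₁)(b₂−a₂)(b₃−a₃)·(b₁(5b₂b₃ − a₂b₃ − b₂a₃ − 3a₂a₃) + a₁(5a₂a₃ − b₂a₃ − a₂b₃ − 3b₂b₃))/24. -/

import Mathlib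

open MeasureTheory

/-- The trilinear monomial `(x + α) (y + β) (z + γ)` on the unit cube, up to an affine function. -/
def cubeMonomial (α β γ x y z : ℝ) : ℝ :=
  x * y * z + α * (y * z) + β * (x * z) + γ * (x * y)

/-- The concave envelope of `cubeMonomial` on the unit cube. -/
def cubeUpper (α β γ x y z : ℝ) : ℝ :=
  min x (min y z) + α * min y z + β * min x z + γ * min x y

/-- The convex envelope of `cubeMonomial` on the unit cube, for `0 ≤ α ≤ β` and `α ≤ γ`. -/
def cubeLower (α β γ x y z : ℝ) : ℝ :=
  (1 + α) * max (z + (x + y - 2)) 0 + α * max (z + (x + y - 1)) 0 +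
    (β - α) * max (z + (x - 1)) 0 + (γ - α) * max (y + (x - 1)) 0

/-- The graph of `cubeMonomial` over the unit cube. -/
def cubeGraph (α β γ : ℝ) : Set (Fin 4 → ℝ) :=
  {p | ∃ x y z : ℝ, x ∈ Set.Icc (0 : ℝ) 1 ∧ y ∈ Set.Icc (0 : ℝ) 1 ∧ z ∈ Set.Icc (0 : ℝ) 1 ∧
    p = ![cubeMonomial α β γ x y z, x, y, z]}

/-- The points over the unit cube lying between `cubeLower` and `cubeUpper`. -/
def cubeRegion (α β γ : ℝ) : Set (Fin 4 → ℝ) :=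
  {p | (p 1 ∈ Set.Icc (0 : ℝ) 1 ∧ p 2 ∈ Set.Icc (0 : ℝ) 1 ∧ p 3 ∈ Set.Icc (0 : ℝ) 1) ∧
    p 0 ∈ Set.Icc (cubeLower α β γ (p 1) (p 2) (p 3)) (cubeUpper α β γ (p 1) (p 2) (p 3))}

lemma max_zero_convex_comb_le {a b u v w : ℝ} (ha : 0 ≤ a) (hb : 0 ≤ b) (hw : w = a * u + b * v) :
    max w 0 ≤ a * max u 0 + b * max v 0 := by
  rw [hw]
  refine max_le (add_le_add ?_ ?_) (by positivity) <;> gcongr <;> exact le_max_left _ _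

lemma convex_comb_min_le {a b u v u' v' w w' : ℝ} (ha : 0 ≤ a) (hb : 0 ≤ b)
    (hw : a * u + b * v ≤ w) (hw' : a * u' + b * v' ≤ w') :
    a * min u u' + b * min v v' ≤ min w w' := by
  refine le_min (le_trans (add_le_add ?_ ?_) hw) (le_trans (add_le_add ?_ ?_) hw') <;> gcongr <;>
    simp

lemma convex_cubeRegion {α β γ : ℝ} (hα : 0 ≤ α) (hαβ : α ≤ β) (hαγ : α ≤ γ) :
    Convex ℝ (cubeRegion α β γ) := by
  rintro p ⟨⟨hp1, hp2, hp3⟩, hpl, hpu⟩ q ⟨⟨hq1, hq2, hq3⟩, hql, hqu⟩ a b ha hb hab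
  refine ⟨⟨convex_Icc 0 1 hp1 hq1 ha hb hab, convex_Icc 0 1 hp2 hq2 ha hb hab,
    convex_Icc 0 1 hp3 hq3 ha hb hab⟩, ?_, ?_⟩
  · have h1 := mul_le_mul_of_nonneg_left (max_zero_convex_comb_le ha hb
      (w := (a * p 3 + b * q 3) + ((a * p 1 + b * q 1) + (a * p 2 + b * q 2) - 2))
      (u := p 3 + (p 1 + p 2 - 2)) (v := q 3 + (q 1 + q 2 - 2))
      (by linear_combination 2 * hab)) (by linarith : 0 ≤ 1 + α)
    have h2 := mul_le_mul_of_nonneg_left (max_zero_convex_comb_le ha hb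
      (w := (a * p 3 + b * q 3) + ((a * p 1 + b * q 1) + (a * p 2 + b * q 2) - 1))
      (u := p 3 + (p 1 + p 2 - 1)) (v := q 3 + (q 1 + q 2 - 1))
      (by linear_combination hab)) hα
    have h3 := mul_le_mul_of_nonneg_left (max_zero_convex_comb_le ha hb
      (w := (a * p 3 + b * q 3) + ((a * p 1 + b * q 1) - 1))
      (u := p 3 + (p 1 - 1)) (v := q 3 + (q 1 - 1))
      (by linear_combination hab)) (sub_nonneg.2 hαβ)
    have h4 := mul_le_mul_of_nonneg_left (max_zero_convex_comb_le ha hb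
      (w := (a * p 2 + b * q 2) + ((a * p 1 + b * q 1) - 1))
      (u := p 2 + (p 1 - 1)) (v := q 2 + (q 1 - 1))
      (by linear_combination hab)) (sub_nonneg.2 hαγ)
    have h5 := mul_le_mul_of_nonneg_left hpl ha
    have h6 := mul_le_mul_of_nonneg_left hql hb
    simp only [cubeLower, Pi.add_apply, Pi.smul_apply, smul_eq_mul] at *
    linarith
  · have h1 := convex_comb_min_le ha hb (le_refl (a * p 1 + b * q 1))
      (convex_comb_min_le ha hb (le_refl (a * p 2 + b * q 2)) (le_refl (a * p 3 + b * q 3)))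
    have h2 := mul_le_mul_of_nonneg_left (convex_comb_min_le ha hb
      (le_refl (a * p 2 + b * q 2)) (le_refl (a * p 3 + b * q 3))) hα
    have h3 := mul_le_mul_of_nonneg_left (convex_comb_min_le ha hb
      (le_refl (a * p 1 + b * q 1)) (le_refl (a * p 3 + b * q 3))) (hα.trans hαβ)
    have h4 := mul_le_mul_of_nonneg_left (convex_comb_min_le ha hb
      (le_refl (a * p 1 + b * q 1)) (le_refl (a * p 2 + b * q 2))) (hα.trans hαγ)
    have h5 := mul_le_mul_of_nonneg_left hpu ha
    have h6 := mul_le_mul_of_nonneg_left hqu hb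
    simp only [cubeUpper, Pi.add_apply, Pi.smul_apply, smul_eq_mul] at *
    linarith

section bounds

variable {x y z : ℝ}

lemma mul_le_min_of_mem_Icc (hx : x ∈ Set.Icc (0 : ℝ) 1) (hy : y ∈ Set.Icc (0 : ℝ) 1) :
    x * y ≤ min x y :=
  le_min (mul_le_of_le_one_right hx.1 hy.2) (mul_le_of_le_one_left hy.1 hx.2)

lemma max_add_sub_one_le_mul (hx : x ∈ Set.Icc (0 : ℝ) 1) (hy : y ∈ Set.Icc (0 : ℝ) 1) :
    max (y + (x - 1)) 0 ≤ x * y :=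
  max_le (by nlinarith [mul_nonneg (sub_nonneg.2 hx.2) (sub_nonneg.2 hy.2)])
    (mul_nonneg hx.1 hy.1)

lemma cubeMonomial_le_cubeUpper {α β γ : ℝ} (hα : 0 ≤ α) (hβ : 0 ≤ β) (hγ : 0 ≤ γ)
    (hx : x ∈ Set.Icc (0 : ℝ) 1) (hy : y ∈ Set.Icc (0 : ℝ) 1) (hz : z ∈ Set.Icc (0 : ℝ) 1) :
    cubeMonomial α β γ x y z ≤ cubeUpper α β γ x y z := by
  have hyz := mul_le_min_of_mem_Icc hy hz
  have hxyz : x * (y * z) ≤ min x (min y z) :=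
    (mul_le_min_of_mem_Icc hx ⟨mul_nonneg hy.1 hz.1, mul_le_one₀ hy.2 hz.1 hz.2⟩).trans
      (min_le_min_left x hyz)
  have h1 := mul_le_mul_of_nonneg_left hyz hα
  have h2 := mul_le_mul_of_nonneg_left (mul_le_min_of_mem_Icc hx hz) hβ
  have h3 := mul_le_mul_of_nonneg_left (mul_le_min_of_mem_Icc hx hy) hγ
  simp only [cubeMonomial, cubeUpper]
  linarith

lemma cubeLower_le_cubeMonomial {α β γ : ℝ} (hα : 0 ≤ α) (hαβ : α ≤ β) (hαγ : α ≤ γ)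
    (hx : x ∈ Set.Icc (0 : ℝ) 1) (hy : y ∈ Set.Icc (0 : ℝ) 1) (hz : z ∈ Set.Icc (0 : ℝ) 1) :
    cubeLower α β γ x y z ≤ cubeMonomial α β γ x y z := by
  have h1 := mul_le_mul_of_nonneg_left (max_add_sub_one_le_mul hx hz) (sub_nonneg.2 hαβ)
  have h2 := mul_le_mul_of_nonneg_left (max_add_sub_one_le_mul hx hy) (sub_nonneg.2 hαγ)
  have hxyz : max (z + (x + y - 2)) 0 ≤ x * y * z := by
    refine le_trans (max_le_max_right 0 ?_) (max_add_sub_one_le_mul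
      ⟨mul_nonneg hx.1 hy.1, mul_le_one₀ hx.2 hy.1 hy.2⟩ hz)
    nlinarith [mul_nonneg (sub_nonneg.2 hx.2) (sub_nonneg.2 hy.2)]
  have hs : max (z + (x + y - 2)) 0 + max (z + (x + y - 1)) 0 ≤ y * z + x * z + x * y := by
    obtain ⟨hx0, hx1⟩ := hx
    obtain ⟨hy0, hy1⟩ := hy
    obtain ⟨hz0, hz1⟩ := hz
    have e1 := mul_nonneg (sub_nonneg.2 hx1) (sub_nonneg.2 hy1)
    have e2 := mul_nonneg (sub_nonneg.2 hx1) (sub_nonneg.2 hz1)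
    have e3 := mul_nonneg (sub_nonneg.2 hy1) (sub_nonneg.2 hz1)
    have e4 := mul_nonneg hx0 hy0
    have e5 := mul_nonneg hx0 hz0
    have e6 := mul_nonneg hy0 hz0
    have e7 := mul_nonneg e4 hz0
    have e8 := mul_nonneg e1 (sub_nonneg.2 hz1)
    rcases max_cases (z + (x + y - 2)) 0 with ⟨h, h'⟩ | ⟨h, h'⟩ <;>
      rcases max_cases (z + (x + y - 1)) 0 with ⟨k, k'⟩ | ⟨k, k'⟩ <;>
      rw [h, k] <;> nlinarith
  have h3 := mul_le_mul_of_nonneg_left hs hα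
  simp only [cubeMonomial, cubeLower]
  linarith

end bounds

lemma mem_convexHull_cubeGraph_of_weights {α β γ x y z w : ℝ} (c : Fin 8 → ℝ)
    (hc : ∀ i, 0 ≤ c i) (hsum : ∑ i, c i = 1) (hx : x = c 1 + c 5 + c 6 + c 7)
    (hy : y = c 2 + c 4 + c 6 + c 7) (hz : z = c 3 + c 4 + c 5 + c 7)
    (hw : w = α * c 4 + β * c 5 + γ * c 6 + (1 + α + β + γ) * c 7) :
    ![w, x, y, z] ∈ convexHull ℝ (cubeGraph α β γ) := by
  have h0 : (0 : ℝ) ∈ Set.Icc (0 : ℝ) 1 := by simp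
  have h1 : (1 : ℝ) ∈ Set.Icc (0 : ℝ) 1 := by simp
  let v (x y z : ℝ) : Fin 4 → ℝ := ![cubeMonomial α β γ x y z, x, y, z]
  have hv {x y z : ℝ} (hx : x ∈ Set.Icc (0 : ℝ) 1) (hy : y ∈ Set.Icc (0 : ℝ) 1)
      (hz : z ∈ Set.Icc (0 : ℝ) 1) : v x y z ∈ convexHull ℝ (cubeGraph α β γ) :=
    subset_convexHull ℝ _ ⟨x, y, z, hx, hy, hz, rfl⟩
  have key := (convex_convexHull ℝ (cubeGraph α β γ)).sum_mem (t := Finset.univ) (w := c)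
    (z := ![v 0 0 0, v 1 0 0, v 0 1 0, v 0 0 1, v 0 1 1, v 1 0 1, v 1 1 0, v 1 1 1])
    (fun i _ => hc i) hsum
    (by
      simp only [Finset.mem_univ, true_implies, Fin.forall_fin_succ]
      exact ⟨hv h0 h0 h0, hv h1 h0 h0, hv h0 h1 h0, hv h0 h0 h1, hv h0 h1 h1, hv h1 h0 h1,
        hv h1 h1 h0, hv h1 h1 h1, fun i => i.elim0⟩)
  convert key using 1
  ext i
  fin_cases i <;> simp [Fin.sum_univ_eight, v, cubeMonomial, hx, hy, hz, hw]
  ring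

section hull

variable {α β γ x y z : ℝ}

lemma cubeUpper_mem_convexHull (hx : x ∈ Set.Icc (0 : ℝ) 1) (hy : y ∈ Set.Icc (0 : ℝ) 1)
    (hz : z ∈ Set.Icc (0 : ℝ) 1) :
    ![cubeUpper α β γ x y z, x, y, z] ∈ convexHull ℝ (cubeGraph α β γ) := by
  obtain ⟨hx0, hx1⟩ := hx
  obtain ⟨hy0, hy1⟩ := hy
  obtain ⟨hz0, hz1⟩ := hz
  let m := min x (min y z)
  refine mem_convexHull_cubeGraph_of_weights
    ![1 - x - y - z + min y z + min x z + min x y - m, x - min x z - min x y + m,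
      y - min y z - min x y + m, z - min y z - min x z + m, min y z - m, min x z - m,
      min x y - m, m] ?_ ?_ ?_ ?_ ?_ ?_
  · simp only [Fin.forall_fin_succ, m]
    rcases le_total x y with hxy | hxy <;> rcases le_total y z with hyz | hyz <;>
      rcases le_total x z with hxz | hxz <;>
      simp [hxy, hyz, hxz] <;> grind
  all_goals simp [Fin.sum_univ_eight, cubeUpper, m]; ring

lemma cubeLower_mem_convexHull (hx : x ∈ Set.Icc (0 : ℝ) 1) (hy : y ∈ Set.Icc (0 : ℝ) 1)
    (hz : z ∈ Set.Icc (0 : ℝ) 1) :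
    ![cubeLower α β γ x y z, x, y, z] ∈ convexHull ℝ (cubeGraph α β γ) := by
  obtain ⟨hx0, hx1⟩ := hx
  obtain ⟨hy0, hy1⟩ := hy
  obtain ⟨hz0, hz1⟩ := hz
  let p := max (z + (x + y - 2)) 0
  let q := max (z + (x + y - 1)) 0
  let r := max (z + (x - 1)) 0
  let s := max (y + (x - 1)) 0
  refine mem_convexHull_cubeGraph_of_weights
    ![1 - x - y - z + q, x - r - s + p, y - q + r, z - q + s, q - r - s, r - p, s - p, p]
    ?_ ?_ ?_ ?_ ?_ ?_
  · simp only [Fin.forall_fin_succ, p, q, r, s]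
    rcases max_cases (z + (x + y - 2)) 0 with ⟨h1, h1'⟩ | ⟨h1, h1'⟩ <;>
      rcases max_cases (z + (x + y - 1)) 0 with ⟨h2, h2'⟩ | ⟨h2, h2'⟩ <;>
      rcases max_cases (z + (x - 1)) 0 with ⟨h3, h3'⟩ | ⟨h3, h3'⟩ <;>
      rcases max_cases (y + (x - 1)) 0 with ⟨h4, h4'⟩ | ⟨h4, h4'⟩ <;>
      simp [h1, h2, h3, h4] <;> grind
  all_goals simp [Fin.sum_univ_eight, cubeLower, p, q, r, s] <;> ring

end hull

lemma convexHull_cubeGraph {α β γ : ℝ} (hα : 0 ≤ α) (hαβ : α ≤ β) (hαγ : α ≤ γ) :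
    convexHull ℝ (cubeGraph α β γ) = cubeRegion α β γ := by
  refine subset_antisymm (convexHull_min ?_ (convex_cubeRegion hα hαβ hαγ)) ?_
  · rintro _ ⟨x, y, z, hx, hy, hz, rfl⟩
    exact ⟨⟨hx, hy, hz⟩, cubeLower_le_cubeMonomial hα hαβ hαγ hx hy hz,
      cubeMonomial_le_cubeUpper hα (hα.trans hαβ) (hα.trans hαγ) hx hy hz⟩
  · rintro p ⟨⟨hx, hy, hz⟩, hw⟩
    have hL := cubeLower_mem_convexHull (α := α) (β := β) (γ := γ) hx hy hz
    have hU := cubeUpper_mem_convexHull (α := α) (β := β) (γ := γ) hx hy hz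
    rw [← segment_eq_Icc (hw.1.trans hw.2)] at hw
    obtain ⟨a, b, ha, hb, hab, h⟩ := hw
    convert convex_convexHull ℝ (cubeGraph α β γ) hL hU ha hb hab using 1
    simp only [smul_eq_mul] at h
    ext i
    fin_cases i <;> simp [← h, ← add_mul, hab]

lemma integral_max_add_const (c : ℝ) (n : ℕ) :
    ∫ x in (0 : ℝ)..1, max (x + c) 0 ^ (n + 1) =
      (max (1 + c) 0 ^ (n + 2) - max c 0 ^ (n + 2)) / (n + 2) := by
  have hn : (n + 2 : ℝ) ≠ 0 := by positivity
  rw [integral_eq_of_hasDerivAt_off_countable (fun x => max (x + c) 0 ^ (n + 2) / (n + 2))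
    (fun x => max (x + c) 0 ^ (n + 1)) (Set.countable_singleton (-c))
    (by fun_prop) ?_ (Continuous.intervalIntegrable (by fun_prop) _ _)]
  · simp; ring
  · rintro x ⟨-, hx⟩
    rcases lt_or_gt_of_ne (show x ≠ -c from hx) with h | h
    · have hev : (fun x => max (x + c) 0 ^ (n + 2) / (n + 2 : ℝ)) =ᶠ[nhds x] fun _ => 0 := by
        filter_upwards [Iio_mem_nhds h] with t ht
        rw [max_eq_right (by linarith [Set.mem_Iio.1 ht])]
        simp
      rw [max_eq_right (by linarith), zero_pow (by lia)]
      exact (hasDerivAt_const x 0).congr_of_eventuallyEq hev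
    · have hev : (fun x => max (x + c) 0 ^ (n + 2) / (n + 2 : ℝ)) =ᶠ[nhds x]
          fun x => (x + c) ^ (n + 2) / (n + 2 : ℝ) := by
        filter_upwards [Ioi_mem_nhds h] with t ht
        rw [max_eq_left (by linarith [Set.mem_Ioi.1 ht])]
      rw [max_eq_left (by linarith)]
      refine HasDerivAt.congr_of_eventuallyEq ?_ hev
      refine HasDerivAt.congr_deriv
        ((((hasDerivAt_id x).add_const c).pow (n + 2)).div_const (n + 2 : ℝ)) ?_
      simp only [id, Nat.cast_add, Nat.cast_ofNat, Nat.add_one_sub_one]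
      field_simp

lemma integral_max_add_const_one {c : ℝ} :
    ∫ x in (0 : ℝ)..1, max (x + c) 0 = (max (1 + c) 0 ^ 2 - max c 0 ^ 2) / 2 := by
  simpa using integral_max_add_const c 0

lemma integral_max_add_const_two {c : ℝ} :
    ∫ x in (0 : ℝ)..1, max (x + c) 0 ^ 2 = (max (1 + c) 0 ^ 3 - max c 0 ^ 3) / 3 := by
  have := integral_max_add_const c 1
  norm_num at this
  exact this

/-- An integral over the unit cube is an iterated interval integral. -/
lemma setIntegral_cube {f : ℝ × ℝ × ℝ → ℝ} (hf : Continuous f) :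
    ∫ t in Set.Icc (0 : ℝ) 1 ×ˢ Set.Icc (0 : ℝ) 1 ×ˢ Set.Icc (0 : ℝ) 1, f t =
      ∫ x in (0 : ℝ)..1, ∫ y in (0 : ℝ)..1, ∫ z in (0 : ℝ)..1, f (x, y, z) := by
  have h2 (x : ℝ) : IntegrableOn (fun t : ℝ × ℝ => f (x, t))
      (Set.Icc (0 : ℝ) 1 ×ˢ Set.Icc (0 : ℝ) 1) :=
    Continuous.continuousOn (by fun_prop) |>.integrableOn_compact (isCompact_Icc.prod isCompact_Icc)
  have h3 : IntegrableOn f (Set.Icc (0 : ℝ) 1 ×ˢ Set.Icc (0 : ℝ) 1 ×ˢ Set.Icc (0 : ℝ) 1) :=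
    hf.continuousOn.integrableOn_compact (isCompact_Icc.prod (isCompact_Icc.prod isCompact_Icc))
  rw [Measure.volume_eq_prod, setIntegral_prod _ h3]
  simp_rw [intervalIntegral.integral_of_le (zero_le_one' ℝ), ← integral_Icc_eq_integral_Ioc]
  congr 1 with x
  rw [Measure.volume_eq_prod, setIntegral_prod _ (h2 x)]

lemma intervalIntegral_congr_unit {f g : ℝ → ℝ} (h : ∀ x ∈ Set.Icc (0 : ℝ) 1, f x = g x) :
    ∫ x in (0 : ℝ)..1, f x = ∫ x in (0 : ℝ)..1, g x :=
  intervalIntegral.integral_congr fun x hx => h x (by simpa using hx)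

lemma integral_min {c : ℝ} (hc : c ∈ Set.Icc (0 : ℝ) 1) :
    ∫ x in (0 : ℝ)..1, min c x = c - c ^ 2 / 2 := by
  have h (x : ℝ) : min c x = x - max (x + -c) 0 := by
    rcases le_total c x with h | h <;> simp [h]
  simp_rw [h]
  rw [intervalIntegral.integral_sub (Continuous.intervalIntegrable (by fun_prop) _ _)
    (Continuous.intervalIntegrable (by fun_prop) _ _), integral_max_add_const_one,
    max_eq_left (by linarith [hc.2]), max_eq_right (by linarith [hc.1]), integral_id]
  ring

lemma integral_min_sq {c : ℝ} (hc : c ∈ Set.Icc (0 : ℝ) 1) :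
    ∫ x in (0 : ℝ)..1, min c x ^ 2 = c ^ 2 - 2 * c ^ 3 / 3 := by
  have h (x : ℝ) : min c x ^ 2 = x ^ 2 - max (x + -c) 0 ^ 2 - 2 * c * max (x + -c) 0 := by
    rcases le_total c x with h | h
    · simp [h]; ring
    · simp [h]
  simp_rw [h]
  rw [intervalIntegral.integral_sub (Continuous.intervalIntegrable (by fun_prop) _ _)
    (Continuous.intervalIntegrable (by fun_prop) _ _),
    intervalIntegral.integral_sub (Continuous.intervalIntegrable (by fun_prop) _ _)
    (Continuous.intervalIntegrable (by fun_prop) _ _), intervalIntegral.integral_const_mul,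
    integral_max_add_const_one, integral_max_add_const_two,
    max_eq_left (by linarith [hc.2]), max_eq_right (by linarith [hc.1]), integral_pow]
  ring

lemma integral_cube_min :
    ∫ x in (0 : ℝ)..1, ∫ y in (0 : ℝ)..1, ∫ z in (0 : ℝ)..1, min x (min y z) = 1 / 4 := by
  rw [intervalIntegral_congr_unit (g := fun x => x - x ^ 2 + x ^ 3 / 3) fun x hx => ?_]
  · rw [intervalIntegral.integral_add (Continuous.intervalIntegrable (by fun_prop) _ _)
      (Continuous.intervalIntegrable (by fun_prop) _ _),
      intervalIntegral.integral_sub (Continuous.intervalIntegrable (by fun_prop) _ _)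
      (Continuous.intervalIntegrable (by fun_prop) _ _), intervalIntegral.integral_div]
    simp; norm_num
  · rw [intervalIntegral_congr_unit (g := fun y => min x y - min x y ^ 2 / 2) fun y hy => ?_,
      intervalIntegral.integral_sub (Continuous.intervalIntegrable (by fun_prop) _ _)
      (Continuous.intervalIntegrable (by fun_prop) _ _), intervalIntegral.integral_div,
      integral_min hx, integral_min_sq hx]
    · ring
    · simp_rw [← min_assoc]
      exact integral_min ⟨le_min hx.1 hy.1, min_le_of_left_le hx.2⟩

lemma integral_cube_max_sub_two :
    ∫ x in (0 : ℝ)..1, ∫ y in (0 : ℝ)..1, ∫ z in (0 : ℝ)..1, max (z + (x + y - 2)) 0 = 1 / 24 := by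
  rw [intervalIntegral_congr_unit (g := fun x => x ^ 3 / 6) fun x hx => ?_]
  · simp; norm_num
  · rw [intervalIntegral_congr_unit (g := fun y => max (y + (x - 1)) 0 ^ 2 / 2) fun y hy => ?_,
      intervalIntegral.integral_div, integral_max_add_const_two, max_eq_left (by linarith [hx.1]),
      max_eq_right (by linarith [hx.2])]
    · ring
    · rw [integral_max_add_const_one, max_eq_right (a := x + y - 2) (by linarith [hx.2, hy.2])]
      ring_nf

lemma integral_cube_max_sub_one :
    ∫ x in (0 : ℝ)..1, ∫ y in (0 : ℝ)..1, ∫ z in (0 : ℝ)..1, max (z + (x + y - 1)) 0 =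
      13 / 24 := by
  rw [intervalIntegral_congr_unit (g := fun x => ((x + 1) ^ 3 - 2 * x ^ 3) / 6) fun x hx => ?_]
  · rw [intervalIntegral.integral_div, intervalIntegral.integral_sub
      (Continuous.intervalIntegrable (by fun_prop) _ _)
      (Continuous.intervalIntegrable (by fun_prop) _ _), intervalIntegral.integral_const_mul,
      intervalIntegral.integral_comp_add_right (fun x => x ^ 3), integral_pow, integral_pow]
    norm_num
  · rw [intervalIntegral_congr_unit
      (g := fun y => (max (y + x) 0 ^ 2 - max (y + (x - 1)) 0 ^ 2) / 2) fun y hy => ?_,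
      intervalIntegral.integral_div, intervalIntegral.integral_sub
      (Continuous.intervalIntegrable (by fun_prop) _ _)
      (Continuous.intervalIntegrable (by fun_prop) _ _), integral_max_add_const_two,
      integral_max_add_const_two, max_eq_left (by linarith [hx.1]), max_eq_left hx.1,
      max_eq_left (by linarith [hx.1]), max_eq_right (by linarith [hx.2])]
    · ring
    · rw [integral_max_add_const_one]
      ring_nf

lemma integral_square_max_sub_one :
    ∫ x in (0 : ℝ)..1, ∫ y in (0 : ℝ)..1, max (y + (x - 1)) 0 = 1 / 6 := by
  rw [intervalIntegral_congr_unit (g := fun x => x ^ 2 / 2) fun x hx => ?_]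
  · simp; norm_num
  · rw [integral_max_add_const_one, max_eq_left (by linarith [hx.1]),
      max_eq_right (by linarith [hx.2])]
    ring

lemma integral_square_min : ∫ x in (0 : ℝ)..1, ∫ y in (0 : ℝ)..1, min x y = 1 / 3 := by
  rw [intervalIntegral_congr_unit fun x hx => integral_min hx,
    intervalIntegral.integral_sub (Continuous.intervalIntegrable (by fun_prop) _ _)
    (Continuous.intervalIntegrable (by fun_prop) _ _), intervalIntegral.integral_div]
  simp; norm_num

lemma setIntegral_cube_sub (α β γ : ℝ) :
    ∫ t in Set.Icc (0 : ℝ) 1 ×ˢ Set.Icc (0 : ℝ) 1 ×ˢ Set.Icc (0 : ℝ) 1,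
      (cubeUpper α β γ t.1 t.2.1 t.2.2 - cubeLower α β γ t.1 t.2.1 t.2.2) =
      (5 + 2 * α + 4 * β + 4 * γ) / 24 := by
  have hint {f : ℝ × ℝ × ℝ → ℝ} (hf : Continuous f) :
      IntegrableOn f (Set.Icc (0 : ℝ) 1 ×ˢ Set.Icc (0 : ℝ) 1 ×ˢ Set.Icc (0 : ℝ) 1) :=
    hf.continuousOn.integrableOn_compact (isCompact_Icc.prod (isCompact_Icc.prod isCompact_Icc))
  simp only [cubeUpper, cubeLower]
  rw [integral_sub (hint (by fun_prop)) (hint (by fun_prop)),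
    integral_add (hint (by fun_prop)) (hint (by fun_prop)),
    integral_add (hint (by fun_prop)) (hint (by fun_prop)),
    integral_add (hint (by fun_prop)) (hint (by fun_prop)),
    integral_add (hint (by fun_prop)) (hint (by fun_prop)),
    integral_add (hint (by fun_prop)) (hint (by fun_prop)),
    integral_add (hint (by fun_prop)) (hint (by fun_prop))]
  simp only [integral_const_mul]
  rw [setIntegral_cube (by fun_prop), setIntegral_cube (by fun_prop),
    setIntegral_cube (by fun_prop), setIntegral_cube (by fun_prop),
    setIntegral_cube (by fun_prop), setIntegral_cube (by fun_prop),
    setIntegral_cube (by fun_prop), setIntegral_cube (by fun_prop)]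
  simp only [integral_cube_min, integral_cube_max_sub_two, integral_cube_max_sub_one,
    intervalIntegral.integral_const, sub_zero, one_smul, integral_square_min,
    integral_square_max_sub_one]
  ring

/-- The coordinates of `ℝ⁴` as a nested product. -/
def finFourEquivProd : (Fin 4 → ℝ) ≃ᵐ ℝ × ℝ × ℝ × ℝ :=
  (MeasurableEquiv.piFinSuccAbove (fun _ => ℝ) 0).trans <|
    (MeasurableEquiv.refl ℝ).prodCongr <|
      (MeasurableEquiv.piFinSuccAbove (fun _ => ℝ) 0).trans <|
        (MeasurableEquiv.refl ℝ).prodCongr (MeasurableEquiv.piFinTwo fun _ => ℝ)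

lemma volume_preserving_finFourEquivProd : MeasurePreserving finFourEquivProd :=
  ((MeasurePreserving.id volume).prod (((MeasurePreserving.id volume).prod
    (volume_preserving_piFinTwo fun _ => ℝ)).comp
      (volume_preserving_piFinSuccAbove (fun _ => ℝ) 0))).comp
    (volume_preserving_piFinSuccAbove (fun _ => ℝ) 0)

lemma volume_cubeRegion {α β γ : ℝ} (hα : 0 ≤ α) (hαβ : α ≤ β) (hαγ : α ≤ γ) :
    volume (cubeRegion α β γ) = ENNReal.ofReal ((5 + 2 * α + 4 * β + 4 * γ) / 24) := by
  let Q : Set (ℝ × ℝ × ℝ) := Set.Icc (0 : ℝ) 1 ×ˢ Set.Icc (0 : ℝ) 1 ×ˢ Set.Icc (0 : ℝ) 1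
  let L (t : ℝ × ℝ × ℝ) : ℝ := cubeLower α β γ t.1 t.2.1 t.2.2
  let U (t : ℝ × ℝ × ℝ) : ℝ := cubeUpper α β γ t.1 t.2.1 t.2.2
  have hL : Continuous L := by unfold L cubeLower; fun_prop
  have hU : Continuous U := by unfold U cubeUpper; fun_prop
  have hQc : IsCompact Q := isCompact_Icc.prod (isCompact_Icc.prod isCompact_Icc)
  let T : Set (ℝ × ℝ × ℝ × ℝ) := {q | q.2 ∈ Q ∧ q.1 ∈ Set.Icc (L q.2) (U q.2)}
  have hT : cubeRegion α β γ = finFourEquivProd ⁻¹' T := rfl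
  have hTc : IsClosed T := (hQc.isClosed.preimage continuous_snd).inter
    ((isClosed_le (hL.comp continuous_snd) continuous_fst).inter
      (isClosed_le continuous_fst (hU.comp continuous_snd)))
  rw [hT, volume_preserving_finFourEquivProd.measure_preimage_equiv, Measure.volume_eq_prod,
    Measure.prod_apply_symm hTc.measurableSet, ← setIntegral_cube_sub α β γ]
  refine Eq.trans ?_ (ofReal_integral_eq_lintegral_ofReal
    ((hU.sub hL).continuousOn.integrableOn_compact hQc) ?_).symm
  · rw [← lintegral_indicator hQc.measurableSet]
    congr 1 with t
    by_cases ht : t ∈ Q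
    · rw [Set.indicator_of_mem ht, Pi.sub_apply, ← Real.volume_Icc]
      congr 1 with w
      simp [T, ht]
    · rw [Set.indicator_of_notMem ht]
      simp [T, ht]
  · filter_upwards [ae_restrict_mem hQc.measurableSet] with t ht
    exact sub_nonneg.2 ((cubeLower_le_cubeMonomial hα hαβ hαγ ht.1 ht.2.1 ht.2.2).trans
      (cubeMonomial_le_cubeUpper hα (hα.trans hαβ) (hα.trans hαγ) ht.1 ht.2.1 ht.2.2))

/-- The linear part of the affine map taking the graph of `cubeMonomial` over the unit cube to the
graph of the trilinear monomial over a box with lower corner `a` and side lengths `d`. -/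
def boxMatrix (a₁ a₂ a₃ d₁ d₂ d₃ : ℝ) : Matrix (Fin 4) (Fin 4) ℝ :=
  !![d₁ * d₂ * d₃, d₁ * a₂ * a₃, a₁ * d₂ * a₃, a₁ * a₂ * d₃;
    0, d₁, 0, 0;
    0, 0, d₂, 0;
    0, 0, 0, d₃]

lemma det_boxMatrix (a₁ a₂ a₃ d₁ d₂ d₃ : ℝ) :
    (boxMatrix a₁ a₂ a₃ d₁ d₂ d₃).det = (d₁ * d₂ * d₃) ^ 2 := by
  simp [boxMatrix, Matrix.det_succ_row_zero, Fin.sum_univ_succ, Fin.succAbove]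
  ring

open scoped Pointwise in
lemma graph_eq_vadd_image_cubeGraph {a₁ a₂ a₃ b₁ b₂ b₃ : ℝ} (hab₁ : a₁ < b₁) (hab₂ : a₂ < b₂)
    (hab₃ : a₃ < b₃) :
    {p : Fin 4 → ℝ | ∃ x₁ x₂ x₃ : ℝ,
        x₁ ∈ Set.Icc a₁ b₁ ∧ x₂ ∈ Set.Icc a₂ b₂ ∧ x₃ ∈ Set.Icc a₃ b₃ ∧
        p = ![x₁ * x₂ * x₃, x₁, x₂, x₃]} =
      ![a₁ * a₂ * a₃, a₁, a₂, a₃] +ᵥ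
        (boxMatrix a₁ a₂ a₃ (b₁ - a₁) (b₂ - a₂) (b₃ - a₃)).toLin' ''
          cubeGraph (a₁ / (b₁ - a₁)) (a₂ / (b₂ - a₂)) (a₃ / (b₃ - a₃)) := by
  have hd₁ := sub_pos.2 hab₁
  have hd₂ := sub_pos.2 hab₂
  have hd₃ := sub_pos.2 hab₃
  have himage (x y z : ℝ) : ![a₁ * a₂ * a₃, a₁, a₂, a₃] +ᵥ
      (boxMatrix a₁ a₂ a₃ (b₁ - a₁) (b₂ - a₂) (b₃ - a₃)).toLin'
        ![cubeMonomial (a₁ / (b₁ - a₁)) (a₂ / (b₂ - a₂)) (a₃ / (b₃ - a₃)) x y z, x, y, z] =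
      ![(a₁ + (b₁ - a₁) * x) * (a₂ + (b₂ - a₂) * y) * (a₃ + (b₃ - a₃) * z),
        a₁ + (b₁ - a₁) * x, a₂ + (b₂ - a₂) * y, a₃ + (b₃ - a₃) * z] := by
    ext i
    fin_cases i <;> simp [boxMatrix, cubeMonomial] <;> field_simp
    ring
  have hparam {a b x : ℝ} (hab : 0 < b - a) (hx : x ∈ Set.Icc a b) :
      (x - a) / (b - a) ∈ Set.Icc (0 : ℝ) 1 ∧ a + (b - a) * ((x - a) / (b - a)) = x :=
    ⟨⟨div_nonneg (sub_nonneg.2 hx.1) hab.le, (div_le_one hab).2 (by linarith [hx.2])⟩,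
      by field_simp; ring⟩
  have hmem {a b t : ℝ} (hab : 0 < b - a) (ht : t ∈ Set.Icc (0 : ℝ) 1) :
      a + (b - a) * t ∈ Set.Icc a b :=
    ⟨by nlinarith [ht.1], by nlinarith [ht.2]⟩
  ext p
  constructor
  · rintro ⟨x₁, x₂, x₃, h₁, h₂, h₃, rfl⟩
    obtain ⟨ht₁, e₁⟩ := hparam hd₁ h₁
    obtain ⟨ht₂, e₂⟩ := hparam hd₂ h₂
    obtain ⟨ht₃, e₃⟩ := hparam hd₃ h₃
    refine ⟨_, ⟨_, ⟨_, _, _, ht₁, ht₂, ht₃, rfl⟩, rfl⟩, ?_⟩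
    simp only [himage, e₁, e₂, e₃]
  · rintro ⟨_, ⟨_, ⟨x, y, z, hx, hy, hz, rfl⟩, rfl⟩, rfl⟩
    exact ⟨_, _, _, hmem hd₁ hx, hmem hd₂ hy, hmem hd₃ hz, himage x y z⟩

theorem trilinear_hull_volume_nonneg
    (a₁ a₂ a₃ b₁ b₂ b₃ : ℝ)
    (ha₁ : 0 ≤ a₁) (ha₂ : 0 ≤ a₂) (ha₃ : 0 ≤ a₃)
    (hab₁ : a₁ < b₁) (hab₂ : a₂ < b₂) (hab₃ : a₃ < b₃)
    (hΩ₁ : a₁ * b₂ ≤ b₁ * a₂) (hΩ₂ : a₁ * b₃ ≤ b₁ * a₃) (hΩ₃ : a₂ * b₃ ≤ b₂ * a₃) :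
    volume (convexHull ℝ {p : Fin 4 → ℝ | ∃ x₁ x₂ x₃ : ℝ,
        x₁ ∈ Set.Icc a₁ b₁ ∧ x₂ ∈ Set.Icc a₂ b₂ ∧ x₃ ∈ Set.Icc a₃ b₃ ∧
        p = ![x₁ * x₂ * x₃, x₁, x₂, x₃]}) =
      ENNReal.ofReal ((b₁ - a₁) * (b₂ - a₂) * (b₃ - a₃) *
        (b₁ * (5 * b₂ * b₃ - a₂ * b₃ - b₂ * a₃ - 3 * a₂ * a₃) +
         a₁ * (5 * a₂ * a₃ - b₂ * a₃ - a₂ * b₃ - 3 * b₂ * b₃)) / 24) := by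
  have hd₁ := sub_pos.2 hab₁
  have hd₂ := sub_pos.2 hab₂
  have hd₃ := sub_pos.2 hab₃
  have hα : 0 ≤ a₁ / (b₁ - a₁) := div_nonneg ha₁ hd₁.le
  have hαβ : a₁ / (b₁ - a₁) ≤ a₂ / (b₂ - a₂) := by
    rw [div_le_div_iff₀ hd₁ hd₂]; linarith
  have hαγ : a₁ / (b₁ - a₁) ≤ a₃ / (b₃ - a₃) := by
    rw [div_le_div_iff₀ hd₁ hd₃]; linarith
  rw [graph_eq_vadd_image_cubeGraph hab₁ hab₂ hab₃, convexHull_vadd, measure_vadd,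
    ← LinearMap.image_convexHull, Measure.addHaar_image_linearMap, LinearMap.det_toLin',
    det_boxMatrix, convexHull_cubeGraph hα hαβ hαγ, volume_cubeRegion hα hαβ hαγ,
    abs_of_nonneg (sq_nonneg _), ← ENNReal.ofReal_mul (sq_nonneg _)]
  congr 1
  field_simp
  ring
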